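/- Let n ≥ 5, a ≥ 0 and p > 1. There exists a constant C, independent of R, of the center x and of u, such that for every smooth stable solution u of Δ²u = |x|^a |u|^{p-1} u on ℝ^n and every ball B_R(x) ⊂ ℝ^n: ∫_{B_R(x)} ( |Δu|² + |y|^a |u|^{p+1} ) dy ≤ C R^{−4} ∫_{B_{2R}(x) \ B_R(x)} u² dy + C R^{−2} ∫_{B_{2R}(x) \ B_R(x)} |u Δu| dy. -/

import Mathlib

open MeasureTheory Metric Set Filter
open scoped RealInnerProductSpace Topology

noncomputable section

/-- The Laplacian of `u : ℝⁿ → ℝ` at `x`, as the sum of the pure second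
partial derivatives in the coordinate directions. -/
def lap (n : ℕ) (u : EuclideanSpace ℝ (Fin n) → ℝ) (x : EuclideanSpace ℝ (Fin n)) : ℝ :=
  ∑ i : Fin n, iteratedFDeriv ℝ 2 u x ![EuclideanSpace.single i 1, EuclideanSpace.single i 1]

/-- `u` solves `Δ²u = |x|^a |u|^(p-1) u` pointwise on `Ω`. -/
def IsSolutionOn (n : ℕ) (a p : ℝ) (u : EuclideanSpace ℝ (Fin n) → ℝ)
    (Ω : Set (EuclideanSpace ℝ (Fin n))) : Prop :=
  ∀ x ∈ Ω, lap n (lap n u) x = ‖x‖ ^ a * |u x| ^ (p - 1) * u x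

/-- `u` is a stable solution on `Ω`:
`p ∫ |x|^a |u|^(p-1) ψ² ≤ ∫ (Δψ)²` for every test function `ψ ∈ C_c^∞(Ω)`. -/
def StableOn (n : ℕ) (a p : ℝ) (u : EuclideanSpace ℝ (Fin n) → ℝ)
    (Ω : Set (EuclideanSpace ℝ (Fin n))) : Prop :=
  ∀ ψ : EuclideanSpace ℝ (Fin n) → ℝ, ContDiff ℝ (⊤ : ℕ∞) ψ → HasCompactSupport ψ →
    tsupport ψ ⊆ Ω →
    p * ∫ x, ‖x‖ ^ a * |u x| ^ (p - 1) * ψ x ^ 2 ≤ ∫ x, lap n ψ x ^ 2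

/-- Surface integral of `f` over the sphere `∂B_r(x)`, with respect to the
`(n-1)`-dimensional Hausdorff measure. -/
def sphInt (n : ℕ) (x : EuclideanSpace ℝ (Fin n)) (r : ℝ)
    (f : EuclideanSpace ℝ (Fin n) → ℝ) : ℝ :=
  ∫ y in sphere x r, f y ∂(Measure.hausdorffMeasure ((n : ℝ) - 1))

/-- Radial derivative of `u` at `y`, relative to the center `x`. -/
def radDeriv (n : ℕ) (x : EuclideanSpace ℝ (Fin n))
    (u : EuclideanSpace ℝ (Fin n) → ℝ) (y : EuclideanSpace ℝ (Fin n)) : ℝ :=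
  ⟪gradient u y, ‖y - x‖⁻¹ • (y - x)⟫

/-- `ℓ₁ = (β+2)(n-4-β) + β(n-2-β)` with `β = (4+a)/(p-1)`. -/
def ell1 (n : ℕ) (a p : ℝ) : ℝ :=
  let β : ℝ := (4 + a) / (p - 1)
  (β + 2) * ((n : ℝ) - 4 - β) + β * ((n : ℝ) - 2 - β)

/-- `ℓ₂ = β(β+2)(n-4-β)(n-2-β)` with `β = (4+a)/(p-1)`. -/
def ell2 (n : ℕ) (a p : ℝ) : ℝ :=
  let β : ℝ := (4 + a) / (p - 1)
  β * (β + 2) * ((n : ℝ) - 4 - β) * ((n : ℝ) - 2 - β)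

/-- The constant `c(n,p,a) = 2(ρ - γ - 1)`, `ρ = n-1-2β`, `γ = β(β-n+2)`. -/
def cConst (n : ℕ) (a p : ℝ) : ℝ :=
  let β : ℝ := (4 + a) / (p - 1)
  2 * (((n : ℝ) - 1 - 2 * β) - β * (β - (n : ℝ) + 2) - 1)

/-- The rescaled energy `E(r; x, u)` from the monotonicity formula. -/
def energyE (n : ℕ) (a p : ℝ) (u : EuclideanSpace ℝ (Fin n) → ℝ)
    (x : EuclideanSpace ℝ (Fin n)) (r : ℝ) : ℝ :=
  let β : ℝ := (4 + a) / (p - 1)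
  r ^ (2 * β + 4 - (n : ℝ)) *
      (∫ y in ball x r,
        (1 / 2) * lap n u y ^ 2 - (1 / (p + 1)) * ‖y‖ ^ a * |u y| ^ (p + 1))
    + β / 2 * ((n : ℝ) - 2 - β) *
        deriv (fun ρ : ℝ => ρ ^ (2 * β + 1 - (n : ℝ)) * sphInt n x ρ fun y => u y ^ 2) r
    + β / 2 * ((n : ℝ) - 2 - β) *
        deriv (fun ρ : ℝ => ρ ^ (2 * β + 2 - (n : ℝ)) * sphInt n x ρ fun y => u y ^ 2) r
    + r ^ 3 / 2 *
        deriv (fun ρ : ℝ => ρ ^ (2 * β + 1 - (n : ℝ)) *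
          sphInt n x ρ fun y => (β * ρ⁻¹ * u y + radDeriv n x u y) ^ 2) r
    + 1 / 2 *
        deriv (fun ρ : ℝ => ρ ^ (2 * β + 4 - (n : ℝ)) *
          sphInt n x ρ fun y => ‖gradient u y‖ ^ 2 - radDeriv n x u y ^ 2) r
    + 1 / 2 * r ^ (2 * β + 3 - (n : ℝ)) *
        (sphInt n x r fun y => ‖gradient u y‖ ^ 2 - radDeriv n x u y ^ 2)

end

/-- The `i`-th partial derivative of `f`. -/
noncomputable def partialDeriv (n : ℕ) (i : Fin n) (f : EuclideanSpace ℝ (Fin n) → ℝ)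
    (x : EuclideanSpace ℝ (Fin n)) : ℝ :=
  fderiv ℝ f x (EuclideanSpace.single i 1)

/-- The pointwise inner product `∇f · ∇g`. -/
noncomputable def gradDot (n : ℕ) (f g : EuclideanSpace ℝ (Fin n) → ℝ)
    (x : EuclideanSpace ℝ (Fin n)) : ℝ :=
  ∑ i : Fin n, partialDeriv n i f x * partialDeriv n i g x

section Calculus

variable {n : ℕ} {f g : EuclideanSpace ℝ (Fin n) → ℝ}

theorem contDiff_partialDeriv (i : Fin n) (hf : ContDiff ℝ (⊤ : ℕ∞) f) :
    ContDiff ℝ (⊤ : ℕ∞) (partialDeriv n i f) :=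
  (hf.fderiv_right (m := (⊤ : ℕ∞)) le_rfl).clm_apply contDiff_const

theorem differentiable_of_contDiff_top (hf : ContDiff ℝ (⊤ : ℕ∞) f) : Differentiable ℝ f :=
  hf.differentiable (by simp)

theorem lap_eq_sum (hf : ContDiff ℝ (⊤ : ℕ∞) f) (x : EuclideanSpace ℝ (Fin n)) :
    lap n f x = ∑ i, partialDeriv n i (partialDeriv n i f) x := by
  refine Finset.sum_congr rfl fun i _ => ?_
  have hd : DifferentiableAt ℝ (fderiv ℝ f) x :=
    (hf.fderiv_right (m := (⊤ : ℕ∞)) le_rfl).differentiable (by simp) x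
  unfold partialDeriv
  rw [iteratedFDeriv_two_apply, fderiv_clm_apply hd (differentiableAt_const _)]
  simp

theorem contDiff_lap (hf : ContDiff ℝ (⊤ : ℕ∞) f) : ContDiff ℝ (⊤ : ℕ∞) (lap n f) := by
  rw [show lap n f = fun x => ∑ i, partialDeriv n i (partialDeriv n i f) x from
    funext (lap_eq_sum hf)]
  exact ContDiff.sum fun i _ => contDiff_partialDeriv i (contDiff_partialDeriv i hf)

theorem contDiff_gradDot (hf : ContDiff ℝ (⊤ : ℕ∞) f) (hg : ContDiff ℝ (⊤ : ℕ∞) g) :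
    ContDiff ℝ (⊤ : ℕ∞) (gradDot n f g) :=
  ContDiff.sum fun i _ => (contDiff_partialDeriv i hf).mul (contDiff_partialDeriv i hg)

theorem partialDeriv_mul (i : Fin n) (hf : Differentiable ℝ f) (hg : Differentiable ℝ g) :
    partialDeriv n i (fun y => f y * g y) =
      fun y => f y * partialDeriv n i g y + g y * partialDeriv n i f y := by
  funext y
  simp [partialDeriv, fderiv_fun_mul (hf y) (hg y)]

theorem partialDeriv_add (i : Fin n) (hf : Differentiable ℝ f) (hg : Differentiable ℝ g) :
    partialDeriv n i (fun y => f y + g y) =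
      fun y => partialDeriv n i f y + partialDeriv n i g y := by
  funext y
  simp [partialDeriv, fderiv_fun_add (hf y) (hg y)]

theorem lap_mul (hf : ContDiff ℝ (⊤ : ℕ∞) f) (hg : ContDiff ℝ (⊤ : ℕ∞) g)
    (x : EuclideanSpace ℝ (Fin n)) :
    lap n (fun y => f y * g y) x = f x * lap n g x + g x * lap n f x + 2 * gradDot n f g x := by
  have df := differentiable_of_contDiff_top hf
  have dg := differentiable_of_contDiff_top hg
  rw [lap_eq_sum (hf.mul hg), lap_eq_sum hf, lap_eq_sum hg, gradDot, Finset.mul_sum,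
    Finset.mul_sum, Finset.mul_sum, ← Finset.sum_add_distrib, ← Finset.sum_add_distrib]
  refine Finset.sum_congr rfl fun i _ => ?_
  have df' := differentiable_of_contDiff_top (contDiff_partialDeriv i hf)
  have dg' := differentiable_of_contDiff_top (contDiff_partialDeriv i hg)
  rw [partialDeriv_mul i df dg, partialDeriv_add i (df.fun_mul dg') (dg.fun_mul df'),
    partialDeriv_mul i df dg', partialDeriv_mul i dg df']
  ring

theorem gradDot_mul_right (hf : ContDiff ℝ (⊤ : ℕ∞) f) (hg : ContDiff ℝ (⊤ : ℕ∞) g)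
    (x : EuclideanSpace ℝ (Fin n)) :
    gradDot n (fun y => f y * g y) g x = f x * gradDot n g g x + g x * gradDot n f g x := by
  simp only [gradDot, partialDeriv_mul _ (differentiable_of_contDiff_top hf)
    (differentiable_of_contDiff_top hg), Finset.mul_sum, ← Finset.sum_add_distrib]
  exact Finset.sum_congr rfl fun i _ => by ring

theorem gradDot_self_nonneg (x : EuclideanSpace ℝ (Fin n)) : 0 ≤ gradDot n f f x :=
  Finset.sum_nonneg fun _ _ => mul_self_nonneg _

theorem gradDot_sq_le (x : EuclideanSpace ℝ (Fin n)) :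
    gradDot n f g x ^ 2 ≤ gradDot n f f x * gradDot n g g x := by
  simpa only [gradDot, pow_two] using Finset.sum_mul_sq_le_sq_mul_sq Finset.univ
    (fun i => partialDeriv n i f x) (fun i => partialDeriv n i g x)

theorem hasCompactSupport_partialDeriv (i : Fin n) (hf : HasCompactSupport f) :
    HasCompactSupport (partialDeriv n i f) :=
  hf.fderiv_apply ℝ _

theorem integral_mul_partialDeriv (i : Fin n) (hf : ContDiff ℝ (⊤ : ℕ∞) f)
    (hg : ContDiff ℝ (⊤ : ℕ∞) g) (hfs : HasCompactSupport f) :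
    ∫ x, f x * partialDeriv n i g x = -∫ x, partialDeriv n i f x * g x :=
  integral_mul_fderiv_eq_neg_fderiv_mul_of_integrable
    (((contDiff_partialDeriv i hf).continuous.mul hg.continuous).integrable_of_hasCompactSupport
      (hasCompactSupport_partialDeriv i hfs).mul_right)
    ((hf.continuous.mul (contDiff_partialDeriv i hg).continuous).integrable_of_hasCompactSupport
      hfs.mul_right)
    ((hf.continuous.mul hg.continuous).integrable_of_hasCompactSupport hfs.mul_right)
    (fun x _ => differentiable_of_contDiff_top hf x)
    (fun x _ => differentiable_of_contDiff_top hg x)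

/-- Green's second identity when one of the functions has compact support. -/
theorem integral_mul_lap (hf : ContDiff ℝ (⊤ : ℕ∞) f) (hg : ContDiff ℝ (⊤ : ℕ∞) g)
    (hfs : HasCompactSupport f) :
    ∫ x, f x * lap n g x = ∫ x, lap n f x * g x := by
  simp only [lap_eq_sum hf, lap_eq_sum hg, Finset.mul_sum, Finset.sum_mul]
  rw [integral_finsetSum, integral_finsetSum]
  · refine Finset.sum_congr rfl fun i _ => ?_
    rw [integral_mul_partialDeriv i hf (contDiff_partialDeriv i hg) hfs,
      integral_mul_partialDeriv i (contDiff_partialDeriv i hf) hg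
        (hasCompactSupport_partialDeriv i hfs), neg_neg]
  · intro i _
    exact ((contDiff_partialDeriv i (contDiff_partialDeriv i hf)).continuous.mul
      hg.continuous).integrable_of_hasCompactSupport (hasCompactSupport_partialDeriv i
        (hasCompactSupport_partialDeriv i hfs)).mul_right
  · intro i _
    exact (hf.continuous.mul (contDiff_partialDeriv i
      (contDiff_partialDeriv i hg)).continuous).integrable_of_hasCompactSupport hfs.mul_right

theorem hasCompactSupport_lap (hf : ContDiff ℝ (⊤ : ℕ∞) f) (hfs : HasCompactSupport f) :
    HasCompactSupport (lap n f) := by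
  refine hfs.mono' fun x hx => ?_
  by_contra h
  refine hx ?_
  rw [lap_eq_sum hf]
  refine Finset.sum_eq_zero fun i _ => ?_
  have h1 := tsupport_fderiv_apply_subset ℝ (f := partialDeriv n i f) (EuclideanSpace.single i 1)
  have h2 := tsupport_fderiv_apply_subset ℝ (f := f) (EuclideanSpace.single i 1)
  exact image_eq_zero_of_notMem_tsupport fun h' => h (h2 (h1 h'))

theorem hasCompactSupport_gradDot_right (hg : HasCompactSupport g) :
    HasCompactSupport (gradDot n f g) := by
  refine hg.mono' fun x hx => ?_
  by_contra h
  refine hx (Finset.sum_eq_zero fun i _ => ?_)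
  simp [partialDeriv, fderiv_of_notMem_tsupport ℝ h]

theorem partialDeriv_comp_smul_sub (i : Fin n) (hf : Differentiable ℝ f) (r c : ℝ)
    (x : EuclideanSpace ℝ (Fin n)) :
    partialDeriv n i (fun y => c * f (r • (y - x))) =
      fun y => (c * r) * partialDeriv n i f (r • (y - x)) := by
  funext y
  have h1 : HasFDerivAt (fun y : EuclideanSpace ℝ (Fin n) => r • (y - x))
      (r • ContinuousLinearMap.id ℝ _) y := ((hasFDerivAt_id y).sub_const x).const_smul r
  have h2 := ((hf (r • (y - x))).hasFDerivAt.comp y h1).const_mul c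
  have h3 : fderiv ℝ (fun y => c * f (r • (y - x))) y = _ := h2.fderiv
  simp [partialDeriv, h3, mul_assoc]

theorem contDiff_comp_smul_sub (hf : ContDiff ℝ (⊤ : ℕ∞) f) (r c : ℝ)
    (x : EuclideanSpace ℝ (Fin n)) :
    ContDiff ℝ (⊤ : ℕ∞) (fun y => c * f (r • (y - x))) :=
  contDiff_const.mul (hf.comp ((contDiff_id.sub contDiff_const).const_smul r))

theorem lap_comp_smul_sub (hf : ContDiff ℝ (⊤ : ℕ∞) f) (r c : ℝ)
    (x y : EuclideanSpace ℝ (Fin n)) :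
    lap n (fun y => c * f (r • (y - x))) y = (c * r ^ 2) * lap n f (r • (y - x)) := by
  rw [lap_eq_sum (contDiff_comp_smul_sub hf r c x), lap_eq_sum hf, Finset.mul_sum]
  refine Finset.sum_congr rfl fun i _ => ?_
  rw [partialDeriv_comp_smul_sub i (differentiable_of_contDiff_top hf),
    partialDeriv_comp_smul_sub i (differentiable_of_contDiff_top (contDiff_partialDeriv i hf))]
  ring

theorem gradDot_self_comp_smul_sub (hf : ContDiff ℝ (⊤ : ℕ∞) f) (r : ℝ)
    (x : EuclideanSpace ℝ (Fin n)) :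
    gradDot n (fun y => 1 * f (r • (y - x))) (fun y => 1 * f (r • (y - x))) =
      fun y => r ^ 2 * gradDot n f f (r • (y - x)) := by
  funext y
  simp only [gradDot, partialDeriv_comp_smul_sub _ (differentiable_of_contDiff_top hf),
    Finset.mul_sum]
  exact Finset.sum_congr rfl fun i _ => by ring

theorem partialDeriv_eventuallyEq_zero (i : Fin n) {c : ℝ} {z : EuclideanSpace ℝ (Fin n)}
    (h : f =ᶠ[𝓝 z] fun _ => c) : partialDeriv n i f =ᶠ[𝓝 z] fun _ => 0 := by
  filter_upwards [h.fderiv (𝕜 := ℝ)] with y hy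
  simp [partialDeriv, hy]

theorem gradDot_self_eventuallyEq_zero {c : ℝ} {z : EuclideanSpace ℝ (Fin n)}
    (h : f =ᶠ[𝓝 z] fun _ => c) : gradDot n f f =ᶠ[𝓝 z] fun _ => 0 := by
  filter_upwards [h.fderiv (𝕜 := ℝ)] with y hy
  simp [gradDot, partialDeriv, hy]

theorem lap_eq_zero_of_eventuallyEq_const (hf : ContDiff ℝ (⊤ : ℕ∞) f) {c : ℝ}
    {z : EuclideanSpace ℝ (Fin n)} (h : f =ᶠ[𝓝 z] fun _ => c) : lap n f z = 0 := by
  rw [lap_eq_sum hf]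
  exact Finset.sum_eq_zero fun i _ =>
    (partialDeriv_eventuallyEq_zero i (partialDeriv_eventuallyEq_zero i h)).eq_of_nhds

/-- `|Δ(uη)|²` and `Δu Δ(uη²)` differ by terms without second derivatives of `u`, up to the
product `u Δu`. -/
theorem lap_mul_sq_sub (hf : ContDiff ℝ (⊤ : ℕ∞) f) (hg : ContDiff ℝ (⊤ : ℕ∞) g)
    (x : EuclideanSpace ℝ (Fin n)) :
    lap n (fun y => f y * g y) x ^ 2 - lap n (fun y => f y * g y * g y) x * lap n f x =
      4 * gradDot n f g x ^ 2 + f x ^ 2 * lap n g x ^ 2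
        + 4 * f x * lap n g x * gradDot n f g x
        - 2 * (f x * lap n f x) * gradDot n g g x := by
  rw [lap_mul (hf.mul hg) hg, gradDot_mul_right hf hg, lap_mul hf hg]
  ring

end Calculus

/-- Cutoff functions between concentric balls of radii `R` and `2R`, with scale-invariant bounds
on their derivatives. -/
theorem exists_cutoff (n : ℕ) :
    ∃ K : ℝ, 0 < K ∧ ∀ (x : EuclideanSpace ℝ (Fin n)) (R : ℝ), 0 < R →
      ∃ η : EuclideanSpace ℝ (Fin n) → ℝ, ContDiff ℝ (⊤ : ℕ∞) η ∧ HasCompactSupport η ∧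
        (∀ y ∈ ball x R, η y = 1) ∧
        (∀ y, gradDot n η η y ≤ K / R ^ 2) ∧
        (∀ y, lap n η y ^ 2 ≤ K / R ^ 4) ∧
        (∀ y, |lap n (gradDot n η η) y| ≤ K / R ^ 4) ∧
        (∀ y, y ∉ ball x (2 * R) \ ball x R →
          gradDot n η η y = 0 ∧ lap n η y = 0 ∧ lap n (gradDot n η η) y = 0) := by
  let b : ContDiffBump (0 : EuclideanSpace ℝ (Fin n)) := ⟨1, 3 / 2, one_pos, by norm_num⟩
  have hb : ContDiff ℝ (⊤ : ℕ∞) (b : EuclideanSpace ℝ (Fin n) → ℝ) := b.contDiff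
  have hbs : HasCompactSupport b := b.hasCompactSupport
  have hφ := contDiff_gradDot hb hb
  have hφs : HasCompactSupport (gradDot n b b) := hasCompactSupport_gradDot_right hbs
  obtain ⟨K₁, hK₁⟩ := hφs.exists_bound_of_continuous hφ.continuous
  obtain ⟨K₂, hK₂⟩ :=
    (hasCompactSupport_lap hb hbs).exists_bound_of_continuous (contDiff_lap hb).continuous
  obtain ⟨K₃, hK₃⟩ :=
    (hasCompactSupport_lap hφ hφs).exists_bound_of_continuous (contDiff_lap hφ).continuous
  have h₁ : 0 ≤ K₁ := (norm_nonneg _).trans (hK₁ 0)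
  have h₃ : 0 ≤ K₃ := (norm_nonneg _).trans (hK₃ 0)
  refine ⟨K₁ + K₂ ^ 2 + K₃ + 1, by positivity, fun x R hR => ?_⟩
  have hηd := contDiff_comp_smul_sub hb R⁻¹ 1 x
  have hgrad := gradDot_self_comp_smul_sub hb R⁻¹ x
  refine ⟨fun y => 1 * b (R⁻¹ • (y - x)), hηd, ?_, ?_, ?_, ?_, ?_, ?_⟩
  · refine HasCompactSupport.intro (isCompact_closedBall x (2 * R)) fun y hy => ?_
    rw [b.zero_of_le_dist, mul_zero]
    rw [mem_closedBall, not_le, dist_eq_norm] at hy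
    change 3 / 2 ≤ _
    rw [dist_zero_right, norm_smul, norm_inv, Real.norm_of_nonneg hR.le, inv_mul_eq_div,
      le_div_iff₀ hR]
    linarith
  · intro y hy
    simp only [one_mul]
    refine b.one_of_mem_closedBall ?_
    rw [mem_ball, dist_eq_norm] at hy
    rw [mem_closedBall, dist_zero_right, norm_smul, norm_inv, Real.norm_of_nonneg hR.le,
      inv_mul_eq_div, div_le_iff₀ hR]
    change _ ≤ 1 * R
    linarith
  · intro y
    rw [hgrad]
    have := (Real.le_norm_self _).trans (hK₁ (R⁻¹ • (y - x)))
    simp only [inv_pow, inv_mul_eq_div]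
    gcongr
    linarith [sq_nonneg K₂]
  · intro y
    rw [lap_comp_smul_sub hb, one_mul, mul_pow, ← pow_mul, inv_pow, inv_mul_eq_div]
    have := pow_le_pow_left₀ (norm_nonneg _) (hK₂ (R⁻¹ • (y - x))) 2
    rw [Real.norm_eq_abs, sq_abs] at this
    gcongr
    linarith
  · intro y
    rw [hgrad, lap_comp_smul_sub hφ, ← pow_add, abs_mul, abs_of_pos (by positivity), inv_pow,
      inv_mul_eq_div]
    have := hK₃ (R⁻¹ • (y - x))
    rw [Real.norm_eq_abs] at this
    gcongr
    linarith [sq_nonneg K₂]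
  · intro y hy
    have hconst : ∃ c : ℝ, b =ᶠ[𝓝 (R⁻¹ • (y - x))] fun _ => c := by
      have hnorm : ‖R⁻¹ • (y - x)‖ = dist y x / R := by
        rw [norm_smul, norm_inv, Real.norm_of_nonneg hR.le, inv_mul_eq_div, dist_eq_norm]
      by_cases h : y ∈ ball x R
      · refine ⟨1, b.eventuallyEq_one_of_mem_ball ?_⟩
        rw [mem_ball, dist_zero_right, hnorm, div_lt_iff₀ hR]
        change _ < 1 * R
        rwa [one_mul]
      · refine ⟨0, notMem_tsupport_iff_eventuallyEq.mp ?_⟩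
        have h2 : 2 * R ≤ dist y x := by
          by_contra h3
          exact hy ⟨not_le.mp h3, h⟩
        rw [b.tsupport_eq, mem_closedBall, dist_zero_right, hnorm, not_le, lt_div_iff₀ hR]
        change 3 / 2 * R < _
        linarith
    obtain ⟨c, hc⟩ := hconst
    have hc' := gradDot_self_eventuallyEq_zero hc
    refine ⟨?_, ?_, ?_⟩
    · rw [hgrad]
      simp [hc'.eq_of_nhds]
    · rw [lap_comp_smul_sub hb, lap_eq_zero_of_eventuallyEq_const hb hc, mul_zero]
    · rw [hgrad, lap_comp_smul_sub hφ, lap_eq_zero_of_eventuallyEq_const hφ hc', mul_zero]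

theorem integral_mul_le_mul_setIntegral {E : Type*} [NormedAddCommGroup E] [MeasurableSpace E]
    [BorelSpace E] [ProperSpace E] {μ : Measure E} [IsFiniteMeasureOnCompacts μ]
    {S : Set E} (hS : MeasurableSet S) (hSb : Bornology.IsBounded S) {F G : E → ℝ}
    (hF : Continuous F) (hG : Continuous G) (hF0 : ∀ y, 0 ≤ F y) {k : ℝ} (hk : ∀ y, G y ≤ k)
    (h0 : ∀ y, y ∉ S → G y = 0) :
    ∫ y, F y * G y ∂μ ≤ k * ∫ y in S, F y ∂μ := by
  have hint : ∀ {H : E → ℝ}, Continuous H → IntegrableOn H S μ := fun hH =>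
    (hH.continuousOn.integrableOn_compact hSb.isCompact_closure).mono_set subset_closure
  rw [← setIntegral_eq_integral_of_forall_compl_eq_zero (s := S)
    (fun y hy => by rw [h0 y hy, mul_zero]), ← integral_const_mul]
  refine setIntegral_mono_on (hint (hF.mul hG)) (hint (continuous_const.mul hF)) hS
    fun y _ => ?_
  rw [mul_comm k]
  exact mul_le_mul_of_nonneg_left (hk y) (hF0 y)

theorem integral_le_of_le_linearCombination {α : Type*} [MeasurableSpace α] {μ : Measure α}
    {F f g h : α → ℝ} (hF : Integrable F μ) (hf : Integrable f μ) (hg : Integrable g μ)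
    (hh : Integrable h μ) {r s t : ℝ} (hle : ∀ y, F y ≤ r * f y + s * g y + t * h y) :
    ∫ y, F y ∂μ ≤ r * (∫ y, f y ∂μ) + s * (∫ y, g y ∂μ) + t * ∫ y, h y ∂μ := by
  have hfg : Integrable (fun y => r * f y + s * g y) μ := (hf.const_mul r).add (hg.const_mul s)
  rw [← integral_const_mul, ← integral_const_mul, ← integral_const_mul,
    ← integral_add (hf.const_mul r) (hg.const_mul s), ← integral_add hfg (hh.const_mul t)]
  exact integral_mono hF (hfg.add (hh.const_mul t)) hle

/-- The energy estimate for a stable solution tested against a cutoff `η` whose derivatives live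
in a bounded set `S`. -/
theorem stable_energy_le (n : ℕ) {a p : ℝ} (ha : 0 ≤ a) (hp : 1 < p)
    {u : EuclideanSpace ℝ (Fin n) → ℝ} (hu : ContDiff ℝ (⊤ : ℕ∞) u)
    (hsol : IsSolutionOn n a p u Set.univ) (hstab : StableOn n a p u Set.univ)
    {η : EuclideanSpace ℝ (Fin n) → ℝ} (hη : ContDiff ℝ (⊤ : ℕ∞) η) (hηs : HasCompactSupport η)
    {S : Set (EuclideanSpace ℝ (Fin n))} (hS : MeasurableSet S) (hSb : Bornology.IsBounded S)
    {k₁ k₂ : ℝ} (h₁ : ∀ y, gradDot n η η y ≤ k₁) (h₂ : ∀ y, lap n η y ^ 2 ≤ k₂)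
    (h₃ : ∀ y, |lap n (gradDot n η η) y| ≤ k₂)
    (h₀ : ∀ y, y ∉ S →
      gradDot n η η y = 0 ∧ lap n η y = 0 ∧ lap n (gradDot n η η) y = 0) :
    ∫ y, (lap n u y ^ 2 + ‖y‖ ^ a * |u y| ^ (p + 1)) * η y ^ 2 ≤
      (4 / (p - 1) + 6) * (15 / 2 * k₂ * (∫ y in S, u y ^ 2) +
        7 * k₁ * ∫ y in S, |u y * lap n u y|) := by
  have hv := contDiff_lap hu
  have hφ := contDiff_gradDot hη hη
  have hφs : HasCompactSupport (gradDot n η η) := hasCompactSupport_gradDot_right hηs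
  have hw : ContDiff ℝ (⊤ : ℕ∞) (fun y => u y * η y) := hu.mul hη
  have hws : HasCompactSupport (fun y => u y * η y) := hηs.mul_left
  have hwη : ContDiff ℝ (⊤ : ℕ∞) (fun y => u y * η y * η y) := hw.mul hη
  have hwηs : HasCompactSupport (fun y => u y * η y * η y) := hηs.mul_left
  have hLw := contDiff_lap hw
  have hLws := hasCompactSupport_lap hw hws
  have hLη := contDiff_lap hη
  have hLηs := hasCompactSupport_lap hη hηs
  have hd := contDiff_gradDot hu hη
  have hds : HasCompactSupport (gradDot n u η) := hasCompactSupport_gradDot_right hηs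
  have hWc : Continuous (fun y : EuclideanSpace ℝ (Fin n) => ‖y‖ ^ a * |u y| ^ (p + 1)) :=
    (continuous_norm.rpow_const fun _ => Or.inr ha).mul
      (hu.continuous.abs.rpow_const fun _ => Or.inr (by linarith))
  have sqs : ∀ {f : EuclideanSpace ℝ (Fin n) → ℝ}, HasCompactSupport f →
      HasCompactSupport (fun y => f y ^ 2) := fun hf =>
    hf.comp_left (g := fun t : ℝ => t ^ 2) (by norm_num)
  have intg : ∀ {f : EuclideanSpace ℝ (Fin n) → ℝ}, Continuous f → HasCompactSupport f →
      Integrable f := fun hf hfs => hf.integrable_of_hasCompactSupport hfs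
  have iE : Integrable (fun y => ‖y‖ ^ a * |u y| ^ (p + 1) * η y ^ 2) :=
    intg (hWc.mul (hη.continuous.pow 2)) (sqs hηs).mul_left
  have iV : Integrable (fun y => lap n u y ^ 2 * η y ^ 2) :=
    intg ((hv.continuous.pow 2).mul (hη.continuous.pow 2)) (sqs hηs).mul_left
  have iW : Integrable (fun y => lap n (fun y => u y * η y) y ^ 2) :=
    intg (hLw.continuous.pow 2) (sqs hLws)
  have iX : Integrable (fun y => lap n (fun y => u y * η y * η y) y * lap n u y) :=
    intg ((contDiff_lap hwη).continuous.mul hv.continuous)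
      (hasCompactSupport_lap hwη hwηs).mul_right
  have iD : Integrable (fun y => gradDot n u η y ^ 2) := intg (hd.continuous.pow 2) (sqs hds)
  have iL : Integrable (fun y => u y ^ 2 * lap n η y ^ 2) :=
    intg ((hu.continuous.pow 2).mul (hLη.continuous.pow 2)) (sqs hLηs).mul_left
  have iP : Integrable (fun y => |u y * lap n u y| * gradDot n η η y) :=
    intg ((hu.continuous.mul hv.continuous).abs.mul hφ.continuous) hφs.mul_left
  have iG : Integrable (fun y => gradDot n η η y * lap n (fun y => u y * u y) y) :=
    intg (hφ.continuous.mul (contDiff_lap (hu.mul hu)).continuous) hφs.mul_right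
  have iLφ : Integrable (fun y => u y ^ 2 * |lap n (gradDot n η η) y|) :=
    intg ((hu.continuous.pow 2).mul (contDiff_lap hφ).continuous.abs)
      ((hasCompactSupport_lap hφ hφs).comp_left (g := fun t : ℝ => |t|) (by norm_num)).mul_left
  have iLφ' : Integrable (fun y => lap n (gradDot n η η) y * (u y * u y)) :=
    intg ((contDiff_lap hφ).continuous.mul (hu.continuous.mul hu.continuous))
      (hasCompactSupport_lap hφ hφs).mul_right
  have bP : ∫ y, |u y * lap n u y| * gradDot n η η y ≤ k₁ * ∫ y in S, |u y * lap n u y| :=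
    integral_mul_le_mul_setIntegral hS hSb (hu.continuous.mul hv.continuous).abs hφ.continuous
      (fun _ => abs_nonneg _) h₁ fun y hy => (h₀ y hy).1
  have bL : ∫ y, u y ^ 2 * lap n η y ^ 2 ≤ k₂ * ∫ y in S, u y ^ 2 :=
    integral_mul_le_mul_setIntegral hS hSb (hu.continuous.pow 2) (hLη.continuous.pow 2)
      (fun _ => sq_nonneg _) h₂ fun y hy => by simp [(h₀ y hy).2.1]
  have bφ : ∫ y, u y ^ 2 * |lap n (gradDot n η η) y| ≤ k₂ * ∫ y in S, u y ^ 2 :=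
    integral_mul_le_mul_setIntegral hS hSb (hu.continuous.pow 2) (contDiff_lap hφ).continuous.abs
      (fun _ => sq_nonneg _) h₃ fun y hy => by simp [(h₀ y hy).2.2]
  have green : ∫ y, gradDot n η η y * lap n (fun y => u y * u y) y =
      ∫ y, lap n (gradDot n η η) y * (u y * u y) := integral_mul_lap hφ (hu.mul hu) hφs
  have bG : ∫ y, gradDot n η η y * lap n (fun y => u y * u y) y ≤
      ∫ y, u y ^ 2 * |lap n (gradDot n η η) y| := by
    rw [green]
    refine integral_mono iLφ' iLφ fun y => ?_
    simp only
    nlinarith [le_abs_self (lap n (gradDot n η η) y), sq_nonneg (u y)]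
  have bD : ∫ y, gradDot n u η y ^ 2 ≤
      1 / 2 * (∫ y, gradDot n η η y * lap n (fun y => u y * u y) y) +
        ∫ y, |u y * lap n u y| * gradDot n η η y := by
    rw [← integral_const_mul, ← integral_add (iG.const_mul _) iP]
    refine integral_mono iD ((iG.const_mul _).add iP) fun y => ?_
    simp only [lap_mul hu hu]
    nlinarith [gradDot_sq_le (f := u) (g := η) y, gradDot_self_nonneg (f := η) y,
      neg_abs_le (u y * lap n u y)]
  have eqn : ∫ y, lap n (fun y => u y * η y * η y) y * lap n u y =
      ∫ y, ‖y‖ ^ a * |u y| ^ (p + 1) * η y ^ 2 := by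
    rw [← integral_mul_lap hwη hv hwηs]
    refine integral_congr_ae (Eventually.of_forall fun y => ?_)
    simp only [hsol y (Set.mem_univ y)]
    rw [show p + 1 = (p - 1) + 2 by ring, Real.rpow_add_of_nonneg (abs_nonneg _) (by linarith)
      (by norm_num), Real.rpow_two, sq_abs]
    ring
  have stab : p * ∫ y, ‖y‖ ^ a * |u y| ^ (p + 1) * η y ^ 2 ≤
      ∫ y, lap n (fun y => u y * η y) y ^ 2 := by
    convert hstab _ hw hws (Set.subset_univ _) using 4 with y
    rw [show p + 1 = (p - 1) + 2 by ring, Real.rpow_add_of_nonneg (abs_nonneg _) (by linarith)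
      (by norm_num), Real.rpow_two, sq_abs]
    ring
  have diff : (∫ y, lap n (fun y => u y * η y) y ^ 2) -
      ∫ y, lap n (fun y => u y * η y * η y) y * lap n u y ≤
      5 * (∫ y, gradDot n u η y ^ 2) + 5 * (∫ y, u y ^ 2 * lap n η y ^ 2) +
        2 * ∫ y, |u y * lap n u y| * gradDot n η η y := by
    rw [← integral_sub iW iX]
    refine integral_le_of_le_linearCombination (iW.sub iX) iD iL iP fun y => ?_
    refine (lap_mul_sq_sub hu hη y).trans_le ?_
    nlinarith [gradDot_self_nonneg (f := η) y, neg_abs_le (u y * lap n u y),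
      sq_nonneg (gradDot n u η y - 2 * (u y * lap n η y))]
  have bV : ∫ y, lap n u y ^ 2 * η y ^ 2 ≤
      3 * (∫ y, lap n (fun y => u y * η y) y ^ 2) + 12 * (∫ y, gradDot n u η y ^ 2) +
        3 * ∫ y, u y ^ 2 * lap n η y ^ 2 := by
    refine integral_le_of_le_linearCombination iV iW iD iL fun y => ?_
    rw [lap_mul hu hη]
    nlinarith [sq_nonneg (η y * lap n u y + 4 * gradDot n u η y + u y * lap n η y),
      sq_nonneg (η y * lap n u y + 2 * gradDot n u η y + 2 * (u y * lap n η y)),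
      sq_nonneg (2 * gradDot n u η y - u y * lap n η y)]
  have split : ∫ y, (lap n u y ^ 2 + ‖y‖ ^ a * |u y| ^ (p + 1)) * η y ^ 2 =
      (∫ y, lap n u y ^ 2 * η y ^ 2) + ∫ y, ‖y‖ ^ a * |u y| ^ (p + 1) * η y ^ 2 := by
    rw [← integral_add iV iE]
    simp only [add_mul]
  rw [split]
  rw [eqn] at diff
  have nD : 0 ≤ ∫ y, gradDot n u η y ^ 2 := integral_nonneg fun _ => sq_nonneg _
  have nL : 0 ≤ ∫ y, u y ^ 2 * lap n η y ^ 2 :=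
    integral_nonneg fun _ => mul_nonneg (sq_nonneg _) (sq_nonneg _)
  have nP : 0 ≤ ∫ y, |u y * lap n u y| * gradDot n η η y :=
    integral_nonneg fun _ => mul_nonneg (abs_nonneg _) (gradDot_self_nonneg _)
  generalize (∫ y in S, u y ^ 2) = J₁ at *
  generalize (∫ y in S, |u y * lap n u y|) = J₂ at *
  generalize (∫ y, ‖y‖ ^ a * |u y| ^ (p + 1) * η y ^ 2) = A at *
  have hQ : 5 * (∫ y, gradDot n u η y ^ 2) + 5 * (∫ y, u y ^ 2 * lap n η y ^ 2) +
      2 * (∫ y, |u y * lap n u y| * gradDot n η η y) ≤ 15 / 2 * k₂ * J₁ + 7 * k₁ * J₂ := by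
    linarith
  generalize 15 / 2 * k₂ * J₁ + 7 * k₁ * J₂ = Q at *
  have hA : A ≤ Q / (p - 1) := by
    rw [le_div_iff₀ (by linarith)]
    linarith
  have : (4 / (p - 1) + 6) * Q = 4 * (Q / (p - 1)) + 6 * Q := by ring
  linarith

/-- Lemma 2.2, estimate (2.16): uniform interior estimate for smooth
stable solutions. -/
theorem stmt7 (n : ℕ) (hn : 5 ≤ n) (a p : ℝ) (ha : 0 ≤ a) (hp : 1 < p) :
    ∃ C : ℝ, 0 < C ∧
      ∀ u : EuclideanSpace ℝ (Fin n) → ℝ, ContDiff ℝ (⊤ : ℕ∞) u →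
        IsSolutionOn n a p u Set.univ → StableOn n a p u Set.univ →
        ∀ (x : EuclideanSpace ℝ (Fin n)) (R : ℝ), 0 < R →
          (∫ y in ball x R, lap n u y ^ 2 + ‖y‖ ^ a * |u y| ^ (p + 1)) ≤
            C / R ^ 4 * (∫ y in ball x (2 * R) \ ball x R, u y ^ 2)
            + C / R ^ 2 * ∫ y in ball x (2 * R) \ ball x R, |u y * lap n u y| := by
  obtain ⟨K, hK, hcut⟩ := exists_cutoff n
  have hp' : 0 < p - 1 := by linarith
  refine ⟨(4 / (p - 1) + 6) * (15 / 2 * K), by positivity, fun u hu hsol hstab x R hR => ?_⟩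
  obtain ⟨η, hη, hηs, hη1, h₁, h₂, h₃, h₀⟩ := hcut x R hR
  have key := stable_energy_le n ha hp hu hsol hstab hη hηs
    (S := ball x (2 * R) \ ball x R) (measurableSet_ball.diff measurableSet_ball)
    (isBounded_ball.subset sdiff_subset) h₁ h₂ h₃ h₀
  have hnn : ∀ y, 0 ≤ lap n u y ^ 2 + ‖y‖ ^ a * |u y| ^ (p + 1) := fun y => by positivity
  have hc : Continuous (fun y => lap n u y ^ 2 + ‖y‖ ^ a * |u y| ^ (p + 1)) :=
    ((contDiff_lap hu).continuous.pow 2).add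
      ((continuous_norm.rpow_const fun _ => Or.inr ha).mul
        (hu.continuous.abs.rpow_const fun _ => Or.inr (by linarith)))
  have hη2s : HasCompactSupport fun y => η y ^ 2 :=
    hηs.comp_left (g := fun t : ℝ => t ^ 2) (by norm_num)
  have hint : Integrable (fun y => (lap n u y ^ 2 + ‖y‖ ^ a * |u y| ^ (p + 1)) * η y ^ 2) :=
    (hc.mul (hη.continuous.pow 2)).integrable_of_hasCompactSupport hη2s.mul_left
  have hJ : 0 ≤ ∫ y in ball x (2 * R) \ ball x R, |u y * lap n u y| :=
    integral_nonneg fun _ => abs_nonneg _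
  calc ∫ y in ball x R, lap n u y ^ 2 + ‖y‖ ^ a * |u y| ^ (p + 1)
      = ∫ y in ball x R, (lap n u y ^ 2 + ‖y‖ ^ a * |u y| ^ (p + 1)) * η y ^ 2 :=
        setIntegral_congr_fun measurableSet_ball fun y hy => by simp [hη1 y hy]
    _ ≤ ∫ y, (lap n u y ^ 2 + ‖y‖ ^ a * |u y| ^ (p + 1)) * η y ^ 2 :=
        setIntegral_le_integral hint
          (Eventually.of_forall fun y => mul_nonneg (hnn y) (sq_nonneg _))
    _ ≤ _ := key
    _ ≤ (4 / (p - 1) + 6) * (15 / 2 * (K / R ^ 4) *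
          (∫ y in ball x (2 * R) \ ball x R, u y ^ 2) +
        15 / 2 * (K / R ^ 2) * ∫ y in ball x (2 * R) \ ball x R, |u y * lap n u y|) := by
        gcongr
        norm_num
    _ = _ := by ring
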